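/- arXiv:1207.3722 — 7 statements merged into one kernel-verified Lean document; each statement's English description precedes it below -/
import Mathlib

section
/- Let T be an arbitrary index set and for each t ∈ T let K_t be a uniform Eberlein compact space. Then the one-point compactification of the topological disjoint sum ⊕_{t∈T} K_t is a uniform Eberlein compact space. -/
open Filter Topology Set MeasureTheory

noncomputable section

/-- The "ball" `B(Γ) = {x ∈ [-1,1]^Γ : ∑_γ |x_γ| ≤ 1}` inside the product `Γ → ℝ`. -/
def BGamma (Γ : Type u) : Set (Γ → ℝ) :=
  {x | (∀ γ, |x γ| ≤ 1) ∧ ∑' γ, ENNReal.ofReal |x γ| ≤ 1}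

/-- A space is uniform Eberlein compact if it is compact Hausdorff and embeds
homeomorphically into some `B(Γ)` with the product (pointwise) topology. -/
def IsUniformEberlein (K : Type u) [TopologicalSpace K] : Prop :=
  CompactSpace K ∧ T2Space K ∧
    ∃ (Γ : Type u) (f : K → ↥(BGamma Γ)), Topology.IsEmbedding f

/-- Extension by zero of a function on the summand `K t` to the one-point compactification of
the disjoint sum. -/
def extendSummand {T : Type u} {K : T → Type u} (t : T) (g : K t → ℝ) :
    OnePoint (Σ t, K t) → ℝ :=
  Function.extend (fun x : K t => ((⟨t, x⟩ : Σ t, K t) : OnePoint (Σ t, K t))) g 0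

section extendSummand

variable {T : Type u} {K : T → Type u}

theorem extendSummand_self (t : T) (g : K t → ℝ) (x : K t) :
    extendSummand t g ((⟨t, x⟩ : Σ t, K t) : OnePoint (Σ t, K t)) = g x :=
  (OnePoint.coe_injective.comp sigma_mk_injective).extend_apply g 0 x

theorem extendSummand_of_ne {s t : T} (hst : s ≠ t) (g : K t → ℝ) (x : K s) :
    extendSummand t g ((⟨s, x⟩ : Σ t, K t) : OnePoint (Σ t, K t)) = 0 := by
  refine Function.extend_apply' _ _ _ ?_
  rintro ⟨y, hy⟩
  exact hst (congrArg Sigma.fst (OnePoint.coe_injective hy)).symm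

theorem extendSummand_infty (t : T) (g : K t → ℝ) :
    extendSummand t g (OnePoint.infty : OnePoint (Σ t, K t)) = 0 := by
  refine Function.extend_apply' _ _ _ ?_
  rintro ⟨y, hy⟩
  exact OnePoint.coe_ne_infty _ hy

theorem continuous_extendSummand [∀ t, TopologicalSpace (K t)] (t : T) [CompactSpace (K t)]
    {g : K t → ℝ} (hg : Continuous g) : Continuous (extendSummand t g) := by
  rw [OnePoint.continuous_iff]
  constructor
  · rw [extendSummand_infty]
    refine tendsto_const_nhds.congr' ?_
    have hmem : (range (Sigma.mk t : K t → Σ t, K t))ᶜ ∈ coclosedCompact (Σ t, K t) :=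
      (isCompact_range continuous_sigmaMk).compl_mem_coclosedCompact_of_isClosed
        isClopen_range_sigmaMk.isClosed
    filter_upwards [hmem]
    rintro ⟨s, x⟩ hx
    refine (extendSummand_of_ne ?_ g x).symm
    rintro rfl
    exact hx ⟨x, rfl⟩
  · refine continuous_sigma fun s => ?_
    by_cases hst : s = t
    · subst hst
      exact hg.congr fun x => (extendSummand_self s g x).symm
    · exact continuous_const.congr fun x => (extendSummand_of_ne hst g x).symm

/-- The map into a product of lines built from coordinate functions `f t` on the summands, with
one additional coordinate for each summand, equal to `1 / 2` on it. -/
def glueCoordinates {Γ : T → Type u} (f : ∀ t, K t → Γ t → ℝ) (p : OnePoint (Σ t, K t)) :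
    T ⊕ (Σ t, Γ t) → ℝ :=
  Sum.elim (fun t => extendSummand t (fun _ => 1 / 2) p)
    (fun c => extendSummand c.1 (fun x => f c.1 x c.2 / 2) p)

theorem continuous_glueCoordinates [∀ t, TopologicalSpace (K t)] [∀ t, CompactSpace (K t)]
    {Γ : T → Type u} {f : ∀ t, K t → Γ t → ℝ} (hf : ∀ t, Continuous (f t)) :
    Continuous (glueCoordinates f) := by
  refine continuous_pi ?_
  rintro (t | ⟨t, γ⟩)
  · exact continuous_extendSummand t continuous_const
  · exact continuous_extendSummand t (((continuous_apply γ).comp (hf t)).div_const 2)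

theorem glueCoordinates_injective {Γ : T → Type u} {f : ∀ t, K t → Γ t → ℝ}
    (hf : ∀ t, Function.Injective (f t)) : Function.Injective (glueCoordinates f) := by
  have hinfty : ∀ y : Σ t, K t,
      glueCoordinates f (OnePoint.infty) ≠ glueCoordinates f (y : OnePoint (Σ t, K t)) := by
    rintro ⟨t, x⟩ h
    have := congrFun h (Sum.inl t)
    simp [glueCoordinates, extendSummand_infty, extendSummand_self] at this
  intro p q hpq
  induction p using OnePoint.rec with
  | infty =>
    induction q using OnePoint.rec with
    | infty => rfl
    | coe y => exact (hinfty y hpq).elim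
  | coe x =>
    induction q using OnePoint.rec with
    | infty => exact (hinfty x hpq.symm).elim
    | coe y =>
      obtain ⟨s, x⟩ := x
      obtain ⟨t, y⟩ := y
      have hst : t = s := by
        by_contra hne
        have := congrFun hpq (Sum.inl s)
        simp [glueCoordinates, extendSummand_self, extendSummand_of_ne hne] at this
      subst hst
      have hxy : x = y := by
        refine hf t (funext fun γ => ?_)
        have := congrFun hpq (Sum.inr ⟨t, γ⟩)
        simpa [glueCoordinates, extendSummand_self] using this
      rw [hxy]

theorem mem_BGamma_of_tsum_le {Γ : Type u} {x : Γ → ℝ}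
    (hx : ∑' γ, ENNReal.ofReal |x γ| ≤ 1) : x ∈ BGamma Γ :=
  ⟨fun γ => ENNReal.ofReal_le_one.1 ((ENNReal.le_tsum γ).trans hx), hx⟩

theorem glueCoordinates_mem_BGamma {Γ : T → Type u} {f : ∀ t, K t → Γ t → ℝ}
    (hf : ∀ t x, f t x ∈ BGamma (Γ t)) (p : OnePoint (Σ t, K t)) :
    glueCoordinates f p ∈ BGamma (T ⊕ (Σ t, Γ t)) := by
  refine mem_BGamma_of_tsum_le ?_
  induction p using OnePoint.rec with
  | infty =>
    have hzero : glueCoordinates f OnePoint.infty = 0 := by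
      ext (t | c) <;> simp [glueCoordinates, extendSummand_infty]
    simp [hzero]
  | coe y =>
    obtain ⟨t, x⟩ := y
    rw [Summable.tsum_sum ENNReal.summable ENNReal.summable, ENNReal.tsum_sigma',
      tsum_eq_single t, tsum_eq_single t]
    · have hhalf : ∀ r : ℝ, ENNReal.ofReal |r / 2| = ENNReal.ofReal |r| * 2⁻¹ := fun r => by
        rw [abs_div, abs_two, ENNReal.ofReal_div_of_pos two_pos, ENNReal.ofReal_ofNat,
          div_eq_mul_inv]
      simp only [glueCoordinates, Sum.elim_inl, Sum.elim_inr, extendSummand_self, hhalf,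
        ENNReal.tsum_mul_right, abs_one, ENNReal.ofReal_one, one_mul]
      calc 2⁻¹ + (∑' γ, ENNReal.ofReal |f t x γ|) * 2⁻¹ ≤ 2⁻¹ + 1 * 2⁻¹ := by
            gcongr
            exact (hf t x).2
        _ = 1 := by rw [one_mul, ENNReal.inv_two_add_inv_two]
    · intro s hs
      simp [glueCoordinates, extendSummand_of_ne hs.symm]
    · intro s hs
      simp [glueCoordinates, extendSummand_of_ne hs.symm]

end extendSummand

/-- The one-point compactification of a disjoint sum of uniform Eberlein compacta
is uniform Eberlein compact. -/
theorem stmt_0 {T : Type u} (K : T → Type u) [∀ t, TopologicalSpace (K t)]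
    (h : ∀ t, IsUniformEberlein (K t)) :
    IsUniformEberlein (OnePoint (Σ t, K t)) := by
  choose hcompact _ Γ f hf using h
  have hcont : Continuous (glueCoordinates fun t x => (f t x).1) :=
    continuous_glueCoordinates fun t => continuous_subtype_val.comp (hf t).continuous
  have hinj : Function.Injective (glueCoordinates fun t x => (f t x).1) :=
    glueCoordinates_injective fun t => Subtype.val_injective.comp (hf t).injective
  refine ⟨inferInstance, T2Space.of_injective_continuous hinj hcont, T ⊕ (Σ t, Γ t),
    fun p => ⟨_, glueCoordinates_mem_BGamma (fun t x => (f t x).2) p⟩, ?_⟩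
  exact (hcont.isClosedEmbedding hinj).isEmbedding.codRestrict _ _
end
end

section
/- Let (X, τ) be a separable metrizable topological space, let f : ℝ → X be an injection (not assumed continuous or measurable), and let S ⊆ ℝ² be such that (f × f)(S) is a Borel subset of the subspace (f × f)(ℝ²) of X × X (i.e., Borel in the subspace topology inherited from the product topology τ × τ). Then S belongs to 𝒫²(ℝ). -/
open Filter Topology Set MeasureTheory

noncomputable section

/-- The σ-field `𝒫ⁿ(ℝ)` on `ℝⁿ` generated by products `A₁ × ⋯ × Aₙ` of arbitrary sets. -/
def prodSigma (n : ℕ) : MeasurableSpace (Fin n → ℝ) :=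
  MeasurableSpace.generateFrom {S | ∃ A : Fin n → Set ℝ, S = Set.univ.pi A}

/-- The σ-field `𝒫²(ℝ)` on `ℝ × ℝ` generated by rectangles `A × B` with `A, B ⊆ ℝ` arbitrary. -/
def P2 : MeasurableSpace (ℝ × ℝ) :=
  MeasurableSpace.generateFrom {S | ∃ A B : Set ℝ, S = A ×ˢ B}

/-- If `f : ℝ → X` is an injection into a separable metrizable space and `(f × f)(S)` is a
Borel subset of the subspace `(f × f)(ℝ²)` of `X × X`, then `S ∈ 𝒫²(ℝ)`. -/
theorem stmt_3 {X : Type*} [TopologicalSpace X] [TopologicalSpace.SeparableSpace X]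
    [TopologicalSpace.MetrizableSpace X]
    (f : ℝ → X) (hf : Function.Injective f) (S : Set (ℝ × ℝ))
    (h : MeasurableSet[borel ↥(Set.range (Prod.map f f))]
      {y : ↥(Set.range (Prod.map f f)) | (y : X × X) ∈ Prod.map f f '' S}) :
    MeasurableSet[P2] S := by
  let : MeasurableSpace X := borel X
  have : BorelSpace X := ⟨rfl⟩
  let := TopologicalSpace.metrizableSpaceMetric X
  have : SecondCountableTopology X := UniformSpace.secondCountable_of_separable X
  let : MeasurableSpace (ℝ × ℝ) := P2
  have rect (A B : Set ℝ) : MeasurableSet (A ×ˢ B) :=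
    MeasurableSpace.measurableSet_generateFrom ⟨A, B, rfl⟩
  have hfst : Measurable fun p : ℝ × ℝ => f p.1 := fun t _ => by
    simpa [Set.prod_univ, Set.preimage_preimage] using rect (f ⁻¹' t) Set.univ
  have hsnd : Measurable fun p : ℝ × ℝ => f p.2 := fun t _ => by
    simpa [Set.univ_prod, Set.preimage_preimage] using rect Set.univ (f ⁻¹' t)
  have hff : Measurable (Prod.map f f) := hfst.prodMk hsnd
  have hrange : Measurable (Set.rangeFactorization (Prod.map f f)) := hff.subtype_mk
  rw [← BorelSpace.measurable_eq] at h
  convert hrange h using 1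
  ext p
  exact ((hf.prodMap hf).mem_set_image).symm
end
end

section
/- Suppose that for every uniform Eberlein compact space K of weight at most 𝔠, the Banach space C(K) embeds isometrically into ℓ∞/c₀. Then 𝔠 is a Kunen cardinal, i.e., every subset of ℝ × ℝ belongs to the σ-field 𝒫²(ℝ) generated by sets of the form A × B with A, B ⊆ ℝ. -/
open Filter Topology Set MeasureTheory

noncomputable section

/-- `ℓ∞`: the Banach space of bounded real sequences with the sup norm. -/
abbrev Linf : Type := lp (fun _ : ℕ => ℝ) ⊤

/-- `c₀`: the subspace of `ℓ∞` of sequences converging to `0`. -/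
def c0 : Submodule ℝ Linf where
  carrier := {x | Filter.Tendsto (fun n => (x : ∀ _ : ℕ, ℝ) n) Filter.atTop (nhds (0 : ℝ))}
  add_mem' := by
    intro a b ha hb
    simpa [lp.coeFn_add, Pi.add_apply] using ha.add hb
  zero_mem' := by
    simpa [lp.coeFn_zero] using
      (tendsto_const_nhds : Filter.Tendsto (fun _ : ℕ => (0 : ℝ)) Filter.atTop (nhds 0))
  smul_mem' := by
    intro c a ha
    simpa [lp.coeFn_smul, Pi.smul_apply, smul_eq_mul] using ha.const_mul c

/-- The quotient Banach space `ℓ∞/c₀` with the quotient norm. -/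
abbrev LinfQuot : Type := Linf ⧸ c0

/-- The weight of a topological space: the minimal cardinality of a base. -/
def tWeight (K : Type u) [TopologicalSpace K] : Cardinal.{u} :=
  sInf {c | ∃ B : Set (Set K), TopologicalSpace.IsTopologicalBasis B ∧ Cardinal.mk B = c}

theorem Linf.abs_apply_le_norm (u : Linf) (n : ℕ) : |u n| ≤ ‖u‖ :=
  lp.norm_apply_le_norm ENNReal.top_ne_zero u n

theorem LinfQuot.norm_mk_le {u : Linf} {r : ℝ} (hr : 0 ≤ r)
    (hu : ∀ᶠ n in atTop, |u n| ≤ r) : ‖(Submodule.Quotient.mk u : LinfQuot)‖ ≤ r := by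
  obtain ⟨m, hm⟩ := eventually_atTop.1 hu
  have hmem : Memℓp (fun n => if m ≤ n then u n else 0) ⊤ := by
    refine memℓp_infty ⟨r, ?_⟩
    rintro _ ⟨n, rfl⟩
    by_cases hn : m ≤ n
    · simpa [hn] using hm n hn
    · simpa [hn] using hr
  let v : Linf := ⟨_, hmem⟩
  have hv : ∀ n, v n = if m ≤ n then u n else 0 := fun _ => rfl
  have huv : (Submodule.Quotient.mk u : LinfQuot) = Submodule.Quotient.mk v := by
    refine (Submodule.Quotient.eq c0).2 ?_
    refine Tendsto.congr' ?_ tendsto_const_nhds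
    filter_upwards [eventually_ge_atTop m] with n hn
    simp [hv, hn]
  rw [huv]
  refine (Submodule.Quotient.norm_mk_le c0 v).trans (lp.norm_le_of_forall_le hr fun n => ?_)
  rw [hv]
  split_ifs with hn
  · exact hm n hn
  · simpa using hr

theorem LinfQuot.eventually_abs_lt {u : Linf} {r : ℝ}
    (hu : ‖(Submodule.Quotient.mk u : LinfQuot)‖ < r) : ∀ᶠ n in atTop, |u n| < r := by
  obtain ⟨v, hv, hvr⟩ := Submodule.Quotient.norm_mk_lt (S := c0)
    (Submodule.Quotient.mk u) (sub_pos.2 hu)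
  have hvr : ‖v‖ < r := by linarith
  have h0 : Tendsto (fun n => (u - v : Linf) n) atTop (𝓝 0) :=
    (Submodule.Quotient.eq c0).1 hv.symm
  filter_upwards [(Metric.tendsto_nhds.1 h0) (r - ‖v‖) (sub_pos.2 hvr)] with n hn
  have h1 : |u n - v n| < r - ‖v‖ := by simpa [Real.dist_eq] using hn
  have h2 := Linf.abs_apply_le_norm v n
  have h3 := abs_sub_abs_le_abs_sub (u n) (v n)
  linarith

/-- The compact set of (indicators of) subsets of `ℝ ⊕ ℝ` meeting each copy of `ℝ` in at most one
point, and such that any pair in it comes from a point of `E`. -/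
def pairFamily (E : Set (ℝ × ℝ)) : Set (ℝ ⊕ ℝ → Bool) :=
  {x | (∀ a b, x (.inl a) = true → x (.inl b) = true → a = b) ∧
    (∀ a b, x (.inr a) = true → x (.inr b) = true → a = b) ∧
    ∀ a b, x (.inl a) = true → x (.inr b) = true → (a, b) ∈ E}

theorem isClosed_setOf_imp_imp {ι : Type*} (i j : ι) (p : Prop) :
    IsClosed {x : ι → Bool | x i = true → x j = true → p} := by
  have h : IsClosed {q : Bool × Bool | q.1 = true → q.2 = true → p} := isClosed_discrete _
  have hc : Continuous fun x : ι → Bool => (x i, x j) := by fun_prop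
  exact h.preimage hc

theorem isClosed_pairFamily (E : Set (ℝ × ℝ)) : IsClosed (pairFamily E) := by
  have h : pairFamily E =
      (⋂ a, ⋂ b, {x | x (.inl a) = true → x (.inl b) = true → a = b}) ∩
      ((⋂ a, ⋂ b, {x | x (.inr a) = true → x (.inr b) = true → a = b}) ∩
      ⋂ a, ⋂ b, {x | x (.inl a) = true → x (.inr b) = true → (a, b) ∈ E}) := by
    ext
    simp only [pairFamily, mem_ofPred_eq, mem_inter_iff, mem_iInter]
  rw [h]
  refine IsClosed.inter ?_ (IsClosed.inter ?_ ?_) <;>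
  exact isClosed_iInter fun a => isClosed_iInter fun b => isClosed_setOf_imp_imp _ _ _

instance (E : Set (ℝ × ℝ)) : CompactSpace (pairFamily E) :=
  isCompact_iff_compactSpace.1 (isClosed_pairFamily E).isCompact

theorem tsum_ite_half_le {x : ℝ → Bool}
    (hx : ∀ a b, x a = true → x b = true → a = b) :
    ∑' a, ENNReal.ofReal |if x a = true then (1 / 2 : ℝ) else 0| ≤ ENNReal.ofReal (1 / 2) := by
  by_cases h : ∃ a, x a = true
  · obtain ⟨a, ha⟩ := h
    rw [tsum_eq_single a]
    · simp [ha]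
    · intro b hb
      have : ¬ x b = true := fun hb' => hb (hx b a hb' ha)
      simp [this]
  · push Not at h
    simp [h]

theorem mem_BGamma_of_mem_pairFamily {E : Set (ℝ × ℝ)} {x : ℝ ⊕ ℝ → Bool}
    (hx : x ∈ pairFamily E) :
    (fun γ => if x γ = true then (1 / 2 : ℝ) else 0) ∈ BGamma (ℝ ⊕ ℝ) := by
  constructor
  · intro γ
    dsimp only
    split_ifs <;> norm_num
  · rw [Summable.tsum_sum ENNReal.summable ENNReal.summable]
    refine (add_le_add (tsum_ite_half_le hx.1) (tsum_ite_half_le hx.2.1)).trans ?_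
    rw [← ENNReal.ofReal_add (by norm_num) (by norm_num)]
    norm_num

theorem isUniformEberlein_pairFamily (E : Set (ℝ × ℝ)) : IsUniformEberlein (pairFamily E) := by
  refine ⟨inferInstance, inferInstance, ℝ ⊕ ℝ,
    fun x => ⟨_, mem_BGamma_of_mem_pairFamily x.2⟩, ?_⟩
  refine (Continuous.isClosedEmbedding ?_ ?_).isEmbedding
  · refine Continuous.subtype_mk (continuous_pi fun γ => ?_) _
    have h : Continuous fun b : Bool => if b = true then (1 / 2 : ℝ) else 0 :=
      continuous_of_discreteTopology
    exact h.comp ((continuous_apply γ).comp continuous_subtype_val)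
  · intro x y hxy
    ext γ
    have := congrFun (congrArg Subtype.val hxy) γ
    rcases hx : x.1 γ <;> rcases hy : y.1 γ <;> simp_all

theorem tWeight_subtype_bool_le {ι : Type} [Infinite ι] (S : Set (ι → Bool)) :
    tWeight S ≤ Cardinal.mk ι := by
  classical
  let c : Finset (ι × Bool) → Set S := fun s => {x | ∀ p ∈ s, x.1 p.1 = p.2}
  have hB : TopologicalSpace.IsTopologicalBasis (range c) := by
    refine TopologicalSpace.isTopologicalBasis_of_isOpen_of_nhds ?_ ?_
    · rintro _ ⟨s, rfl⟩
      have : c s = ⋂ p ∈ s, {x : S | x.1 p.1 = p.2} := by ext; simp [c]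
      rw [this]
      refine isOpen_biInter_finset fun p _ => ?_
      have hc : Continuous fun x : S => x.1 p.1 :=
        (continuous_apply p.1).comp continuous_subtype_val
      exact (isOpen_discrete {p.2}).preimage hc
    · rintro x U hxU ⟨V, hV, rfl⟩
      obtain ⟨I, u, hu, hIV⟩ := isOpen_pi_iff.1 hV x.1 hxU
      refine ⟨_, ⟨I.image fun i => (i, x.1 i), rfl⟩, ?_, ?_⟩
      · intro p hp
        obtain ⟨i, -, rfl⟩ := Finset.mem_image.1 hp
        rfl
      · intro y hy
        refine hIV fun i hi => ?_
        have : y.1 i = x.1 i := hy (i, x.1 i) (Finset.mem_image_of_mem _ hi)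
        rw [this]
        exact (hu i hi).2
  calc tWeight S ≤ Cardinal.mk (range c) := csInf_le' ⟨_, hB, rfl⟩
    _ ≤ Cardinal.mk (Finset (ι × Bool)) := Cardinal.mk_range_le
    _ = Cardinal.mk ι := by
      rw [Cardinal.mk_finset_of_infinite]
      simp [Cardinal.mul_eq_left (Cardinal.aleph0_le_mk ι)
        (Cardinal.ofNat_le_aleph0.trans (Cardinal.aleph0_le_mk ι))]

/-- The evaluation at `γ` as a continuous `{0, 1}`-valued function on `pairFamily E`. -/
def pairFamilyEval (E : Set (ℝ × ℝ)) (γ : ℝ ⊕ ℝ) : C(pairFamily E, ℝ) where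
  toFun x := if x.1 γ = true then 1 else 0
  continuous_toFun :=
    (continuous_of_discreteTopology (f := fun b : Bool => if b = true then (1 : ℝ) else 0)).comp
      ((continuous_apply γ).comp continuous_subtype_val)

theorem two_le_norm_pairFamilyEval_add {E : Set (ℝ × ℝ)} {a b : ℝ} (hab : (a, b) ∈ E) :
    2 ≤ ‖pairFamilyEval E (.inl a) + pairFamilyEval E (.inr b)‖ := by
  classical
  let x : pairFamily E := ⟨Sum.elim (fun t => decide (t = a)) (fun t => decide (t = b)), by
    refine ⟨?_, ?_, ?_⟩ <;> intro s t hs ht <;> simp_all⟩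
  have h := ContinuousMap.norm_coe_le_norm
    (pairFamilyEval E (.inl a) + pairFamilyEval E (.inr b)) x
  have hx : (pairFamilyEval E (.inl a) + pairFamilyEval E (.inr b)) x = 2 := by
    simp [pairFamilyEval, x]
    norm_num
  rw [hx] at h
  simpa using h

theorem norm_pairFamilyEval_add_le_one {E : Set (ℝ × ℝ)} {a b : ℝ} (hab : (a, b) ∉ E) :
    ‖pairFamilyEval E (.inl a) + pairFamilyEval E (.inr b)‖ ≤ 1 := by
  refine (ContinuousMap.norm_le _ zero_le_one).2 fun x => ?_
  have := x.2.2.2 a b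
  by_cases ha : x.1 (.inl a) = true <;> by_cases hb : x.1 (.inr b) = true <;>
    simp_all [pairFamilyEval]

theorem measurable_P2_comp_fst (f : ℝ → ℝ) : Measurable[P2] fun p : ℝ × ℝ => f p.1 := by
  intro s _
  refine MeasurableSpace.measurableSet_generateFrom ⟨f ⁻¹' s, univ, ?_⟩
  ext; simp

theorem measurable_P2_comp_snd (f : ℝ → ℝ) : Measurable[P2] fun p : ℝ × ℝ => f p.2 := by
  intro s _
  refine MeasurableSpace.measurableSet_generateFrom ⟨univ, f ⁻¹' s, ?_⟩
  ext; simp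

/-- If for every uniform Eberlein compact space of weight at most `𝔠` the space `C(K)` embeds
isometrically into `ℓ∞/c₀`, then `𝔠` is a Kunen cardinal, i.e. every subset of `ℝ × ℝ`
belongs to `𝒫²(ℝ)`. -/
theorem stmt_4
    (h : ∀ (K : Type) [TopologicalSpace K] [CompactSpace K],
      IsUniformEberlein K → tWeight K ≤ Cardinal.continuum →
      Nonempty (C(K, ℝ) →ₗᵢ[ℝ] LinfQuot)) :
    ∀ E : Set (ℝ × ℝ), MeasurableSet[P2] E := by
  intro E
  have hw : tWeight (pairFamily E) ≤ Cardinal.continuum :=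
    (tWeight_subtype_bool_le (pairFamily E)).trans (by simp [Cardinal.mk_real])
  obtain ⟨T⟩ := h (pairFamily E) (isUniformEberlein_pairFamily E) hw
  choose u hu using fun γ => Submodule.Quotient.mk_surjective c0 (T (pairFamilyEval E γ))
  have hnorm : ∀ a b, ‖(Submodule.Quotient.mk (u (.inl a) + u (.inr b)) : LinfQuot)‖ =
      ‖pairFamilyEval E (.inl a) + pairFamilyEval E (.inr b)‖ := by
    intro a b
    rw [Submodule.Quotient.mk_add, hu, hu, ← map_add, T.norm_map]
  have hE : E = ⋂ m : ℕ, ⋃ n : ℕ, ⋃ _ : m ≤ n,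
      {p : ℝ × ℝ | 3 / 2 < |u (.inl p.1) n + u (.inr p.2) n|} := by
    ext ⟨a, b⟩
    simp only [mem_iInter, mem_iUnion, mem_ofPred_eq, exists_prop]
    constructor
    · intro hab
      by_contra! hcon
      obtain ⟨m, hm⟩ := hcon
      have h1 := LinfQuot.norm_mk_le (u := u (.inl a) + u (.inr b)) (r := 3 / 2) (by norm_num)
        (eventually_atTop.2 ⟨m, hm⟩)
      rw [hnorm] at h1
      linarith [two_le_norm_pairFamilyEval_add hab]
    · intro hfreq
      by_contra hab
      have h1 : ‖(Submodule.Quotient.mk (u (.inl a) + u (.inr b)) : LinfQuot)‖ < 3 / 2 := by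
        rw [hnorm]
        linarith [norm_pairFamilyEval_add_le_one hab]
      obtain ⟨m, hm⟩ := eventually_atTop.1 (LinfQuot.eventually_abs_lt h1)
      obtain ⟨n, hmn, hn⟩ := hfreq m
      exact lt_asymm hn (hm n hmn)
  rw [hE]
  let : MeasurableSpace (ℝ × ℝ) := P2
  refine MeasurableSet.iInter fun m => MeasurableSet.iUnion fun n => MeasurableSet.iUnion fun _ => ?_
  have hmeas := (measurable_P2_comp_fst fun a => u (.inl a) n).add
    (measurable_P2_comp_snd fun b => u (.inr b) n)
  exact hmeas ((isOpen_lt continuous_const continuous_abs).measurableSet (s := {t : ℝ | 3 / 2 < |t|}))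
end
end

section
/- Let (X, τ) be a separable metrizable topological space, let f : ℝ → X be an injection, let n ≥ 2 be an integer, and let A, B ⊆ ℝⁿ. If the image fⁿ(A) can be separated from fⁿ(B) by a Borel subset of Xⁿ (i.e., there is a Borel set W ⊆ Xⁿ with fⁿ(A) ⊆ W and fⁿ(B) ∩ W = ∅), then A can be separated from B by a member of 𝒫ⁿ(ℝ) (i.e., there is S ∈ 𝒫ⁿ(ℝ) with A ⊆ S and B ∩ S = ∅). -/
open Filter Topology Set MeasureTheory

noncomputable section

/-- Every coordinate projection is measurable for `prodSigma n` and the discrete σ-field. -/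
lemma measurableSet_prodSigma_eval_preimage {n : ℕ} (i : Fin n) (T : Set ℝ) :
    MeasurableSet[prodSigma n] ((fun x : Fin n → ℝ => x i) ⁻¹' T) := by
  refine MeasurableSpace.measurableSet_generateFrom ⟨fun j => {t | j = i → t ∈ T}, ?_⟩
  ext x
  simp

/-- Preimages of Borel sets under a product map lie in `prodSigma n`. -/
lemma measurableSet_preimage_of_borel {X : Type*} [TopologicalSpace X]
    [TopologicalSpace.SeparableSpace X] [TopologicalSpace.MetrizableSpace X]
    {n : ℕ} (f : ℝ → X) {W : Set (Fin n → X)} (hW : MeasurableSet[borel (Fin n → X)] W) :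
    MeasurableSet[prodSigma n] ((fun (x : Fin n → ℝ) (i : Fin n) => f (x i)) ⁻¹' W) := by
  let : MeasurableSpace X := borel X
  have : BorelSpace X := ⟨rfl⟩
  let := TopologicalSpace.metrizableSpaceMetric X
  have : SecondCountableTopology X := UniformSpace.secondCountable_of_separable X
  rw [← (inferInstance : BorelSpace (Fin n → X)).measurable_eq] at hW
  let : MeasurableSpace (Fin n → ℝ) := prodSigma n
  have hF : Measurable (fun (x : Fin n → ℝ) (i : Fin n) => f (x i)) :=
    measurable_pi_lambda _ fun i T _ =>
      measurableSet_prodSigma_eval_preimage i (f ⁻¹' T)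
  exact hF hW

/-- If `f : ℝ → X` is an injection into a separable metrizable space, `n ≥ 2`, and the images
`fⁿ(A)` and `fⁿ(B)` can be separated by a Borel subset of `Xⁿ`, then `A` and `B` can be
separated by a member of `𝒫ⁿ(ℝ)`. -/
theorem stmt_6 {X : Type*} [TopologicalSpace X] [TopologicalSpace.SeparableSpace X]
    [TopologicalSpace.MetrizableSpace X]
    (f : ℝ → X) (hf : Function.Injective f) (n : ℕ) (hn : 2 ≤ n)
    (A B : Set (Fin n → ℝ))
    (h : ∃ W : Set (Fin n → X), MeasurableSet[borel (Fin n → X)] W ∧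
      (fun (x : Fin n → ℝ) (i : Fin n) => f (x i)) '' A ⊆ W ∧
      ((fun (x : Fin n → ℝ) (i : Fin n) => f (x i)) '' B) ∩ W = ∅) :
    ∃ S : Set (Fin n → ℝ), MeasurableSet[prodSigma n] S ∧ A ⊆ S ∧ B ∩ S = ∅ := by
  obtain ⟨W, hW, hAW, hBW⟩ := h
  let F : (Fin n → ℝ) → Fin n → X := fun x i => f (x i)
  refine ⟨F ⁻¹' W, measurableSet_preimage_of_borel f hW, image_subset_iff.mp hAW, ?_⟩
  rw [← disjoint_iff_inter_eq_empty] at hBW ⊢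
  exact disjoint_image_left.mp hBW
end
end

section
/- Suppose that for every uniform Eberlein compact space K of weight at most 𝔠, the Banach space C(K) embeds isomorphically into ℓ∞/c₀. Then for every binary relation E ⊆ ℝ² there are only finitely many positive integers n for which the set E^[n] cannot be separated from (E^c)^[n] by a member of 𝒫ⁿ(ℝ); that is, for all but finitely many n there exists S ∈ 𝒫ⁿ(ℝ) with E^[n] ⊆ S and (E^c)^[n] ∩ S = ∅. -/
open Filter Topology Set MeasureTheory

noncomputable section

/-- `E^[n]`: tuples `(x₁,…,xₙ)` of pairwise distinct reals with `(x_i, x_j) ∈ E` for `i < j`. -/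
def Esec (E : Set (ℝ × ℝ)) (n : ℕ) : Set (Fin n → ℝ) :=
  {x | ∀ i j : Fin n, i < j → x i ≠ x j ∧ (x i, x j) ∈ E}

/-- Labelled reals: the index set of the coordinate functions of `cliqueCompact`. A triple
`⟨n, i, x⟩` says that the real `x` is placed in position `i` of an `n`-tuple. -/
abbrev LabelledReal : Type := Σ n : ℕ, Fin n × ℝ

/-- Two labelled reals are compatible for `E` if they occupy different positions of tuples of the
same length and are related by `E` in the order of these positions. -/
def Compatible (E : Set (ℝ × ℝ)) (a b : LabelledReal) : Prop :=
  a.1 = b.1 ∧ (a.2.1 : ℕ) ≠ b.2.1 ∧ ((a.2.1 : ℕ) < b.2.1 → (a.2.2, b.2.2) ∈ E) ∧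
    ((b.2.1 : ℕ) < a.2.1 → (b.2.2, a.2.2) ∈ E)

/-- The space of all sets of pairwise compatible labelled reals, as characteristic functions. -/
def cliqueCompact (E : Set (ℝ × ℝ)) : Set (LabelledReal → Bool) :=
  {A | ∀ a b, a ≠ b → A a = true → A b = true → Compatible E a b}

lemma isClosed_cliqueCompact (E : Set (ℝ × ℝ)) : IsClosed (cliqueCompact E) := by
  have hrep : cliqueCompact E = ⋂ (a : LabelledReal) (b : LabelledReal),
      {A | a ≠ b → A a = true → A b = true → Compatible E a b} := by
    ext A
    simp [cliqueCompact]
  rw [hrep]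
  refine isClosed_iInter fun a => isClosed_iInter fun b => ?_
  have hcont : Continuous fun A : LabelledReal → Bool => (A a, A b) := by fun_prop
  exact (isClosed_discrete {p : Bool × Bool |
    a ≠ b → p.1 = true → p.2 = true → Compatible E a b}).preimage hcont

instance compactSpace_cliqueCompact (E : Set (ℝ × ℝ)) : CompactSpace (cliqueCompact E) :=
  isCompact_iff_compactSpace.mp (isClosed_cliqueCompact E).isCompact

/-- The weighted characteristic function of a set of labelled reals. -/
def weightedIndicator (A : LabelledReal → Bool) (a : LabelledReal) : ℝ :=
  if A a = true then (a.1 : ℝ)⁻¹ else 0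

lemma weightedIndicator_nonneg (A : LabelledReal → Bool) (a : LabelledReal) :
    0 ≤ weightedIndicator A a := by
  unfold weightedIndicator
  split_ifs <;> positivity

lemma sum_weightedIndicator_le_one {E : Set (ℝ × ℝ)} {A : LabelledReal → Bool}
    (hA : A ∈ cliqueCompact E) (s : Finset LabelledReal) :
    ∑ a ∈ s, weightedIndicator A a ≤ 1 := by
  classical
  simp only [weightedIndicator]
  rw [← Finset.sum_filter]
  rcases (s.filter fun a => A a = true).eq_empty_or_nonempty with he | ⟨a₀, ha₀⟩
  · simp [he]
  · have hn : ∀ a ∈ s.filter (fun a => A a = true), a.1 = a₀.1 := by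
      intro a ha
      by_cases h : a = a₀
      · rw [h]
      · exact (hA a a₀ h (Finset.mem_filter.mp ha).2 (Finset.mem_filter.mp ha₀).2).1
    have hpos : (0 : ℝ) < a₀.1 := by
      have := a₀.2.1.pos
      exact_mod_cast this
    have hcard : (s.filter fun a => A a = true).card ≤ a₀.1 := by
      have hle := Finset.card_le_card_of_injOn (s := s.filter fun a => A a = true)
        (t := Finset.range a₀.1) (fun a => (a.2.1 : ℕ))
        (fun a ha => by
          exact Finset.mem_coe.mpr (Finset.mem_range.mpr (a.2.1.isLt.trans_eq (hn a ha))))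
        (fun a ha b hb hab => by
          by_contra h
          exact (hA a b h (Finset.mem_filter.mp ha).2 (Finset.mem_filter.mp hb).2).2.1 hab)
      simpa using hle
    rw [Finset.sum_congr rfl fun a ha => by rw [hn a ha], Finset.sum_const, nsmul_eq_mul,
      ← div_eq_mul_inv, div_le_one hpos]
    exact_mod_cast hcard

lemma weightedIndicator_mem_BGamma {E : Set (ℝ × ℝ)} {A : LabelledReal → Bool}
    (hA : A ∈ cliqueCompact E) : weightedIndicator A ∈ BGamma LabelledReal := by
  refine ⟨fun a => ?_, ?_⟩
  · rw [abs_of_nonneg (weightedIndicator_nonneg A a)]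
    simpa using sum_weightedIndicator_le_one hA {a}
  · simp only [abs_of_nonneg (weightedIndicator_nonneg A _)]
    rw [ENNReal.tsum_eq_iSup_sum]
    refine iSup_le fun s => ?_
    rw [← ENNReal.ofReal_sum_of_nonneg fun a _ => weightedIndicator_nonneg A a]
    exact ENNReal.ofReal_le_one.mpr (sum_weightedIndicator_le_one hA s)

lemma continuous_weightedIndicator : Continuous weightedIndicator := by
  refine continuous_pi fun a => ?_
  exact (continuous_of_discreteTopology (f := fun t : Bool =>
    if t = true then (a.1 : ℝ)⁻¹ else 0)).comp (continuous_apply a)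

lemma injective_weightedIndicator : Function.Injective weightedIndicator := by
  intro A B hAB
  funext a
  have hne : (a.1 : ℝ)⁻¹ ≠ 0 := inv_ne_zero (Nat.cast_ne_zero.mpr a.2.1.pos.ne')
  have h : (if A a = true then (a.1 : ℝ)⁻¹ else 0) = if B a = true then (a.1 : ℝ)⁻¹ else 0 :=
    congrFun hAB a
  refine Bool.eq_iff_iff.mpr ?_
  split_ifs at h with hA hB hB
  · exact iff_of_true hA hB
  · exact absurd h hne
  · exact absurd h.symm hne
  · exact iff_of_false hA hB

lemma isUniformEberlein_cliqueCompact (E : Set (ℝ × ℝ)) :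
    IsUniformEberlein (cliqueCompact E) := by
  refine ⟨inferInstance, inferInstance, LabelledReal,
    fun A => ⟨weightedIndicator A, weightedIndicator_mem_BGamma A.2⟩, ?_⟩
  refine (Continuous.isClosedEmbedding ?_ ?_).isEmbedding
  · exact (continuous_weightedIndicator.comp continuous_subtype_val).subtype_mk _
  · intro A B hAB
    exact Subtype.ext (injective_weightedIndicator (congrArg Subtype.val hAB))

lemma mk_labelledReal_le : Cardinal.mk LabelledReal ≤ Cardinal.continuum := by
  have hinj : Function.Injective fun a : LabelledReal => ((a.1, (a.2.1 : ℕ)), a.2.2) := by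
    rintro ⟨n, i, x⟩ ⟨m, j, y⟩ h
    simp only [Prod.mk.injEq] at h
    obtain ⟨⟨rfl, hij⟩, rfl⟩ := h
    rw [Fin.ext hij]
  refine (Cardinal.mk_le_of_injective hinj).trans ?_
  simp [Cardinal.mk_real]

/-- The basis of the topology of a space of characteristic functions prescribing finitely many
elements and finitely many non-elements has at most `𝔠` members if there are at most `𝔠`
coordinates. -/
lemma tWeight_subtype_bool_le_s6 {Γ : Type} (hΓ : Cardinal.mk Γ ≤ Cardinal.continuum)
    (K : Set (Γ → Bool)) : tWeight K ≤ Cardinal.continuum := by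
  classical
  let U : Finset Γ × Finset Γ → Set K := fun p =>
    {A | (∀ a ∈ p.1, A.1 a = true) ∧ ∀ a ∈ p.2, A.1 a = false}
  have hopen : ∀ (a : Γ) (t : Bool), IsOpen {A : K | A.1 a = t} := fun a t =>
    (isOpen_discrete ({t} : Set Bool)).preimage
      ((continuous_apply a).comp continuous_subtype_val : Continuous fun A : K => A.1 a)
  have hbasis : TopologicalSpace.IsTopologicalBasis (Set.range U) := by
    refine TopologicalSpace.isTopologicalBasis_of_isOpen_of_nhds ?_ ?_
    · rintro _ ⟨p, rfl⟩
      have hU : U p = (⋂ a ∈ p.1, {A : K | A.1 a = true}) ∩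
          ⋂ a ∈ p.2, {A : K | A.1 a = false} := by
        ext A
        simp [U]
      rw [hU]
      exact (isOpen_biInter_finset fun a _ => hopen a _).inter
        (isOpen_biInter_finset fun a _ => hopen a _)
    · intro A V hAV hV
      obtain ⟨W, hW, rfl⟩ := isOpen_induced_iff.mp hV
      obtain ⟨I, u, hu, hsub⟩ := isOpen_pi_iff.mp hW A.1 hAV
      refine ⟨_, ⟨(I.filter fun a => A.1 a = true, I.filter fun a => A.1 a = false), rfl⟩,
        by simp [U], ?_⟩
      rintro B ⟨hB₁, hB₂⟩
      refine hsub fun a ha => ?_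
      have hBA : B.1 a = A.1 a := by
        cases h : A.1 a
        · exact hB₂ a (Finset.mem_filter.mpr ⟨ha, h⟩)
        · exact hB₁ a (Finset.mem_filter.mpr ⟨ha, h⟩)
      rw [hBA]
      exact (hu a ha).2
  have hweight : tWeight K ≤ Cardinal.mk (Set.range U) := csInf_le' ⟨_, hbasis, rfl⟩
  refine hweight.trans ?_
  refine Cardinal.mk_range_le.trans ?_
  have hfin : Cardinal.mk (Finset Γ) ≤ Cardinal.continuum := by
    rcases finite_or_infinite Γ with hf | hi
    · exact (Cardinal.lt_aleph0_of_finite _).le.trans Cardinal.aleph0_le_continuum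
    · rw [Cardinal.mk_finset_of_infinite]
      exact hΓ
  rw [Cardinal.mk_prod, Cardinal.lift_id]
  exact (mul_le_mul' hfin hfin).trans Cardinal.continuum_mul_self.le

/-- The coordinate function of `cliqueCompact E` given by a labelled real. -/
def cliqueCoord (E : Set (ℝ × ℝ)) (a : LabelledReal) : C(cliqueCompact E, ℝ) where
  toFun A := if A.1 a = true then 1 else 0
  continuous_toFun :=
    (continuous_of_discreteTopology (f := fun t : Bool => if t = true then (1 : ℝ) else 0)).comp
      ((continuous_apply a).comp continuous_subtype_val)

lemma le_norm_sum_cliqueCoord {E : Set (ℝ × ℝ)} {n : ℕ} {x : Fin n → ℝ} (hx : x ∈ Esec E n) :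
    (n : ℝ) ≤ ‖∑ i, cliqueCoord E ⟨n, i, x i⟩‖ := by
  classical
  let A : LabelledReal → Bool := fun a => decide (∃ i, a = ⟨n, i, x i⟩)
  have hA : A ∈ cliqueCompact E := by
    intro a b hab ha hb
    obtain ⟨i, rfl⟩ := of_decide_eq_true ha
    obtain ⟨j, rfl⟩ := of_decide_eq_true hb
    refine ⟨rfl, fun hij => hab ?_, fun hij => (hx i j hij).2, fun hji => (hx j i hji).2⟩
    obtain rfl : i = j := Fin.ext hij
    rfl
  have hval : (∑ i, cliqueCoord E ⟨n, i, x i⟩) ⟨A, hA⟩ = n := by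
    rw [ContinuousMap.sum_apply]
    simp [cliqueCoord, A]
  calc (n : ℝ) = ‖(∑ i, cliqueCoord E ⟨n, i, x i⟩) ⟨A, hA⟩‖ := by rw [hval]; simp
    _ ≤ _ := ContinuousMap.norm_coe_le_norm _ _

lemma norm_sum_cliqueCoord_le_one {E : Set (ℝ × ℝ)} {n : ℕ} {x : Fin n → ℝ}
    (hx : x ∈ Esec Eᶜ n) : ‖∑ i, cliqueCoord E ⟨n, i, x i⟩‖ ≤ 1 := by
  refine (ContinuousMap.norm_le _ zero_le_one).mpr fun A => ?_
  rw [ContinuousMap.sum_apply]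
  simp only [cliqueCoord, ContinuousMap.coe_mk, Finset.sum_boole, Real.norm_natCast]
  norm_cast
  refine Finset.card_le_one.mpr fun i hi j hj => ?_
  have hAi := (Finset.mem_filter.mp hi).2
  have hAj := (Finset.mem_filter.mp hj).2
  by_contra hij
  have hc := A.2 ⟨n, i, x i⟩ ⟨n, j, x j⟩ (by simp [hij]) hAi hAj
  rcases lt_or_gt_of_ne hij with hlt | hlt
  · exact (hx i j hlt).2 (hc.2.2.1 hlt)
  · exact (hx j i hlt).2 (hc.2.2.2 hlt)

lemma eventually_abs_le_of_norm_mk_lt {u : Linf} {r : ℝ} (hu : ‖c0.mkQ u‖ < r) :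
    ∀ᶠ k in atTop, |u k| ≤ r := by
  obtain ⟨v, hv, hvr⟩ := Submodule.Quotient.norm_mk_lt (c0.mkQ u) (sub_pos.mpr hu)
  rw [add_sub_cancel] at hvr
  have huv : Tendsto (fun k => (u - v : Linf) k) atTop (𝓝 0) :=
    (Submodule.Quotient.eq c0).mp hv.symm
  have hsmall := huv.abs.eventually_lt_const
    (show |(0 : ℝ)| < r - ‖v‖ by simpa using hvr)
  filter_upwards [hsmall] with k hk
  have hvk : |v k| ≤ ‖v‖ := lp.norm_apply_le_norm ENNReal.top_ne_zero v k
  have htri : |u k| ≤ |u k - v k| + |v k| := by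
    simpa using abs_add_le (u k - v k) (v k)
  have hk' : |u k - v k| < r - ‖v‖ := hk
  linarith

lemma norm_mk_le_of_eventually_abs_le {u : Linf} {r : ℝ} (hr : 0 ≤ r)
    (hu : ∀ᶠ k in atTop, |u k| ≤ r) : ‖c0.mkQ u‖ ≤ r := by
  classical
  have hbound : ∀ k, ‖if |u k| ≤ r then u k else 0‖ ≤ r := fun k => by
    split_ifs with hk
    · exact hk
    · simpa using hr
  let v : Linf := ⟨fun k => if |u k| ≤ r then u k else 0,
    memℓp_infty ⟨r, by rintro _ ⟨k, rfl⟩; exact hbound k⟩⟩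
  have huv : c0.mkQ u = c0.mkQ v := by
    refine (Submodule.Quotient.eq c0).mpr (tendsto_const_nhds.congr' ?_)
    filter_upwards [hu] with k hk
    have hvk : v k = u k := if_pos hk
    change 0 = u k - v k
    rw [hvk, sub_self]
  rw [huv]
  exact (Submodule.Quotient.norm_mk_le c0 v).trans (lp.norm_le_of_forall_le hr hbound)

lemma measurable_prodSigma_coord {n : ℕ} (i : Fin n) (φ : ℝ → ℝ) :
    Measurable[prodSigma n] fun x : Fin n → ℝ => φ (x i) := by
  classical
  intro B _
  refine MeasurableSpace.measurableSet_generateFrom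
    ⟨fun j => if j = i then φ ⁻¹' B else Set.univ, ?_⟩
  ext x
  simp only [Set.mem_preimage, Set.mem_univ_pi]
  refine ⟨fun hx j => ?_, fun hx => by simpa using hx i⟩
  split_ifs with hj
  · rwa [hj]
  · trivial

lemma measurableSet_frequently_sum {n : ℕ} (φ : Fin n → ℝ → ℕ → ℝ) (r : ℝ) :
    MeasurableSet[prodSigma n] {x | ¬ ∀ᶠ k in atTop, |∑ i, φ i (x i) k| ≤ r} := by
  let := prodSigma n
  have hk : ∀ k, MeasurableSet {x : Fin n → ℝ | |∑ i, φ i (x i) k| ≤ r} := fun k => by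
    have hm : Measurable fun x : Fin n → ℝ => ∑ i, φ i (x i) k :=
      Finset.measurable_fun_sum _ fun i _ => measurable_prodSigma_coord i fun t => φ i t k
    exact measurableSet_le (continuous_abs.measurable.comp hm) measurable_const
  have hrep : {x : Fin n → ℝ | ¬ ∀ᶠ k in atTop, |∑ i, φ i (x i) k| ≤ r} =
      (⋃ N, ⋂ k, ⋂ (_ : N ≤ k), {x : Fin n → ℝ | |∑ i, φ i (x i) k| ≤ r})ᶜ := by
    ext x
    simp [eventually_atTop]
  rw [hrep]
  exact (MeasurableSet.iUnion fun _ => MeasurableSet.iInter fun k =>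
    MeasurableSet.iInter fun _ => hk k).compl

/-- If for every uniform Eberlein compact space of weight at most `𝔠` the space `C(K)` embeds
isomorphically into `ℓ∞/c₀`, then for every `E ⊆ ℝ²` there are only finitely many positive
integers `n` for which `E^[n]` cannot be separated from `(Eᶜ)^[n]` by a member of `𝒫ⁿ(ℝ)`. -/
theorem stmt_7
    (h : ∀ (K : Type) [TopologicalSpace K] [CompactSpace K],
      IsUniformEberlein K → tWeight K ≤ Cardinal.continuum →
      ∃ T : C(K, ℝ) →L[ℝ] LinfQuot, Function.Injective T ∧
        ∃ c > 0, ∀ g : C(K, ℝ), c * ‖g‖ ≤ ‖T g‖) :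
    ∀ E : Set (ℝ × ℝ),
      {n : ℕ | 0 < n ∧ ¬ ∃ S : Set (Fin n → ℝ), MeasurableSet[prodSigma n] S ∧
        Esec E n ⊆ S ∧ Esec Eᶜ n ∩ S = ∅}.Finite := by
  intro E
  obtain ⟨T, -, c, hc, hT⟩ := h (cliqueCompact E) (isUniformEberlein_cliqueCompact E)
    (tWeight_subtype_bool_le_s6 mk_labelledReal_le _)
  choose f hf using fun a : LabelledReal => c0.mkQ_surjective (T (cliqueCoord E a))
  obtain ⟨N, hN⟩ := exists_nat_gt ((‖T‖ + 1) / c)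
  refine (Set.finite_Iio N).subset ?_
  rintro n ⟨-, hn⟩
  by_contra hNn
  have hnc : ‖T‖ + 1 < c * n := by
    have hle : (N : ℝ) ≤ n := by exact_mod_cast not_lt.mp hNn
    rw [mul_comm]
    exact (div_lt_iff₀ hc).mp (hN.trans_le hle)
  have hmk : ∀ x : Fin n → ℝ, c0.mkQ (∑ i, f ⟨n, i, x i⟩) =
      T (∑ i, cliqueCoord E ⟨n, i, x i⟩) := fun x => by simp only [map_sum, hf]
  have hcoe : ∀ (x : Fin n → ℝ) (k : ℕ),
      (∑ i, f ⟨n, i, x i⟩ : Linf) k = ∑ i, f ⟨n, i, x i⟩ k := fun x k => by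
    rw [lp.coeFn_sum, Finset.sum_apply]
  refine hn ⟨_, measurableSet_frequently_sum (fun i t k => f ⟨n, i, t⟩ k) (‖T‖ + 1), ?_, ?_⟩
  · intro x hx hev
    simp only [← hcoe] at hev
    have h₁ := norm_mk_le_of_eventually_abs_le (by positivity) hev
    rw [hmk] at h₁
    have h₂ := hT (∑ i, cliqueCoord E ⟨n, i, x i⟩)
    have h₃ := mul_le_mul_of_nonneg_left (le_norm_sum_cliqueCoord hx) hc.le
    linarith
  · refine Set.eq_empty_of_forall_notMem ?_
    rintro x ⟨hx, hxS⟩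
    refine hxS ?_
    simp only [← hcoe]
    refine eventually_abs_le_of_norm_mk_lt ?_
    rw [hmk]
    have h₁ := T.le_opNorm_of_le (norm_sum_cliqueCoord_le_one hx)
    linarith
end
end

section
/- If 𝔠 is not a Kunen cardinal (i.e., not every subset of ℝ × ℝ belongs to the σ-field 𝒫²(ℝ)), then there exists a uniform Eberlein compact space K such that the Banach space C(K) embeds isomorphically into ℓ∞/c₀ but does not embed isometrically into ℓ∞/c₀. -/
open Filter Topology Set MeasureTheory

noncomputable section

/-! ### The quotient norm of `ℓ∞/c₀` -/

theorem mem_c0_iff {a : Linf} : a ∈ c0 ↔ Tendsto (fun n => a n) atTop (𝓝 (0 : ℝ)) := Iff.rfl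

theorem isClosed_c0 : IsClosed (c0 : Set Linf) := by
  refine isClosed_of_closure_subset fun a ha => ?_
  rw [SetLike.mem_coe, mem_c0_iff, Metric.tendsto_atTop]
  intro ε hε
  obtain ⟨b, hb, hab⟩ := Metric.mem_closure_iff.1 ha (ε / 2) (half_pos hε)
  obtain ⟨N, hN⟩ := Metric.tendsto_atTop.1 (mem_c0_iff.1 hb) (ε / 2) (half_pos hε)
  refine ⟨N, fun n hn => ?_⟩
  have h₁ := lp.norm_apply_le_norm ENNReal.top_ne_zero (a - b) n
  have h₂ := hN n hn
  rw [dist_eq_norm] at hab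
  rw [Real.dist_eq, sub_zero, abs_lt] at *
  rw [lp.coeFn_sub, Pi.sub_apply, Real.norm_eq_abs] at h₁
  have h₃ := abs_le.1 (h₁.trans hab.le)
  constructor <;> linarith [h₃.1, h₃.2, h₂.1, h₂.2]

theorem norm_mk_le_of_eventually {a : Linf} {c : ℝ} (hc : 0 ≤ c)
    (h : ∀ᶠ n in atTop, |a n| ≤ c) : ‖(c0.mkQ a : LinfQuot)‖ ≤ c := by
  obtain ⟨N, hN⟩ := eventually_atTop.1 h
  have hmem : Memℓp (fun n => if N ≤ n then a n else 0) ⊤ := by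
    refine memℓp_infty ⟨c, ?_⟩
    rintro _ ⟨n, rfl⟩
    by_cases hn : N ≤ n
    · simpa [hn] using hN n hn
    · simpa [hn] using hc
  let b : Linf := ⟨_, hmem⟩
  have hb : ‖b‖ ≤ c := by
    refine lp.norm_le_of_forall_le hc fun n => ?_
    by_cases hn : N ≤ n
    · simpa [b, hn] using hN n hn
    · simpa [b, hn] using hc
  have hab : c0.mkQ a = c0.mkQ b := by
    rw [← sub_eq_zero, ← map_sub, Submodule.mkQ_apply, Submodule.Quotient.mk_eq_zero, mem_c0_iff]
    refine tendsto_const_nhds.congr' ?_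
    filter_upwards [eventually_ge_atTop N] with n hn
    have hbn : b n = a n := if_pos hn
    rw [lp.coeFn_sub, Pi.sub_apply, hbn, sub_self]
  rw [hab]
  exact (Submodule.Quotient.norm_mk_le c0 b).trans hb

theorem eventually_lt_of_norm_mk_lt {a : Linf} {c : ℝ} (h : ‖(c0.mkQ a : LinfQuot)‖ < c) :
    ∀ᶠ n in atTop, |a n| < c := by
  obtain ⟨b, hb, hbc⟩ := Submodule.Quotient.norm_mk_lt (S := c0) (c0.mkQ a) (sub_pos.2 h)
  rw [add_sub_cancel] at hbc
  have hab : a - b ∈ c0 := by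
    rw [← Submodule.Quotient.mk_eq_zero, Submodule.Quotient.mk_sub, hb]
    exact sub_self _
  have h₀ := (mem_c0_iff.1 hab).eventually (Metric.ball_mem_nhds 0 (sub_pos.2 hbc))
  filter_upwards [h₀] with n hn
  have h₁ := lp.norm_apply_le_norm ENNReal.top_ne_zero b n
  change dist ((a - b) n) 0 < c - ‖b‖ at hn
  rw [Real.dist_eq, sub_zero, lp.coeFn_sub, Pi.sub_apply] at hn
  rw [Real.norm_eq_abs] at h₁
  calc |a n| = |(a n - b n) + b n| := by rw [sub_add_cancel]
    _ ≤ |a n - b n| + |b n| := abs_add_le _ _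
    _ < c := by linarith

/-! ### An almost disjoint family and the copy of `c₀(2^ℕ)` it spans -/

/-- The codes of the finite initial segments of `z`. -/
def branchCodes (z : ℕ → Bool) : Set ℕ :=
  range fun m : ℕ => Encodable.encode (List.ofFn fun i : Fin m => z i)

theorem branchCodes_infinite (z : ℕ → Bool) : (branchCodes z).Infinite := by
  refine infinite_range_of_injective fun m m' h => ?_
  simpa using congrArg List.length (Encodable.encode_injective h)

theorem branchCodes_inter_finite {z z' : ℕ → Bool} (h : z ≠ z') :
    (branchCodes z ∩ branchCodes z').Finite := by
  obtain ⟨i, hi⟩ := Function.ne_iff.1 h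
  refine ((finite_Iic i).image
    fun m : ℕ => Encodable.encode (List.ofFn fun j : Fin m => z j)).subset ?_
  rintro _ ⟨⟨m, rfl⟩, ⟨m', hm'⟩⟩
  refine ⟨m, ?_, rfl⟩
  have hl := Encodable.encode_injective hm'
  have hmm : m' = m := by simpa using congrArg List.length hl
  subst hmm
  by_contra hlt
  exact hi (congrFun (List.ofFn_injective hl) ⟨i, not_le.1 hlt⟩).symm

/-- The indicator of `branchCodes z`, as an element of `ℓ∞`. -/
def branchIndicator (z : ℕ → Bool) : Linf :=
  ⟨(branchCodes z).indicator 1, memℓp_infty ⟨1, by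
    rintro _ ⟨n, rfl⟩
    by_cases hn : n ∈ branchCodes z <;> simp [hn]⟩⟩

theorem branchIndicator_of_mem {z : ℕ → Bool} {n : ℕ} (h : n ∈ branchCodes z) :
    branchIndicator z n = 1 := by
  simp [branchIndicator, h]

theorem branchIndicator_of_notMem {z : ℕ → Bool} {n : ℕ} (h : n ∉ branchCodes z) :
    branchIndicator z n = 0 := by
  simp [branchIndicator, h]

variable {ι : Type*}

theorem eventually_pairwise_notMem (φ : ι ↪ (ℕ → Bool)) (t : Finset ι) :
    ∀ᶠ n in atTop, ∀ k ∈ t, n ∈ branchCodes (φ k) → ∀ l ∈ t, l ≠ k → n ∉ branchCodes (φ l) := by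
  have h : ∀ k ∈ t, ∀ l ∈ t, ∀ᶠ n in atTop,
      n ∈ branchCodes (φ k) → l ≠ k → n ∉ branchCodes (φ l) := by
    intro k _ l _
    by_cases hkl : l = k
    · simp [hkl]
    · have := (branchCodes_inter_finite (φ.injective.ne hkl)).compl_mem_cofinite
      rw [Nat.cofinite_eq_atTop] at this
      filter_upwards [this] with n hn hk _ hl using hn ⟨hl, hk⟩
  have h' := (eventually_all_finset t).2 fun k hk => (eventually_all_finset t).2 (h k hk)
  filter_upwards [h'] with n hn k hk hnk l hl hlk using hn k hk l hl hnk hlk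

theorem sum_branchIndicator_apply {φ : ι ↪ (ℕ → Bool)} {t : Finset ι} (a : ι → ℝ) {n : ℕ} {k : ι}
    (hk : k ∈ t) (hn : n ∈ branchCodes (φ k))
    (h : ∀ l ∈ t, l ≠ k → n ∉ branchCodes (φ l)) :
    (∑ l ∈ t, a l • branchIndicator (φ l) : Linf) n = a k := by
  rw [lp.coeFn_sum, Finset.sum_apply, Finset.sum_eq_single_of_mem k hk]
  · simp [branchIndicator_of_mem hn]
  · intro l hl hlk
    simp [branchIndicator_of_notMem (h l hl hlk)]

theorem norm_sum_smul_branch_le (φ : ι ↪ (ℕ → Bool)) (t : Finset ι) (a : ι → ℝ) {c : ℝ}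
    (hc : 0 ≤ c) (h : ∀ k ∈ t, |a k| ≤ c) :
    ‖(∑ k ∈ t, a k • c0.mkQ (branchIndicator (φ k)) : LinfQuot)‖ ≤ c := by
  simp_rw [← map_smul, ← map_sum]
  refine norm_mk_le_of_eventually hc ?_
  filter_upwards [eventually_pairwise_notMem φ t] with n hn
  by_cases hk : ∃ k ∈ t, n ∈ branchCodes (φ k)
  · obtain ⟨k, hk, hnk⟩ := hk
    rw [sum_branchIndicator_apply a hk hnk (hn k hk hnk)]
    exact h k hk
  · push Not at hk
    rw [lp.coeFn_sum, Finset.sum_apply, Finset.sum_eq_zero]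
    · simpa using hc
    · intro l hl
      simp [branchIndicator_of_notMem (hk l hl)]

theorem le_norm_sum_smul_branch (φ : ι ↪ (ℕ → Bool)) (t : Finset ι) (a : ι → ℝ) {k : ι}
    (hk : k ∈ t) :
    |a k| ≤ ‖(∑ k ∈ t, a k • c0.mkQ (branchIndicator (φ k)) : LinfQuot)‖ := by
  simp_rw [← map_smul, ← map_sum]
  by_contra! hlt
  obtain ⟨n, hnk, hn, hn'⟩ := ((Nat.frequently_atTop_iff_infinite.2
    (branchCodes_infinite (φ k))).and_eventually
      ((eventually_pairwise_notMem φ t).and (eventually_lt_of_norm_mk_lt hlt))).exists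
  rw [sum_branchIndicator_apply a hk hnk (hn k hk hnk)] at hn'
  exact lt_irrefl _ hn'

theorem summable_smul_branch (φ : ι ↪ (ℕ → Bool)) {a : ι → ℝ}
    (ha : ∀ ε > 0, {k | ε ≤ |a k|}.Finite) :
    Summable fun k => (a k • c0.mkQ (branchIndicator (φ k)) : LinfQuot) := by
  rw [summable_iff_vanishing_norm]
  intro ε hε
  refine ⟨(ha (ε / 2) (half_pos hε)).toFinset, fun t ht => ?_⟩
  refine (norm_sum_smul_branch_le φ t a (half_pos hε).le fun k hk => ?_).trans_lt (half_lt_self hε)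
  by_contra! hlt
  exact Finset.disjoint_left.1 ht hk (by simpa using hlt.le)

theorem norm_tsum_smul_branch_le (φ : ι ↪ (ℕ → Bool)) {a : ι → ℝ}
    (ha : ∀ ε > 0, {k | ε ≤ |a k|}.Finite) {c : ℝ} (hc : 0 ≤ c) (h : ∀ k, |a k| ≤ c) :
    ‖(∑' k, a k • c0.mkQ (branchIndicator (φ k)) : LinfQuot)‖ ≤ c :=
  le_of_tendsto (summable_smul_branch φ ha).hasSum.norm
    (Eventually.of_forall fun t => norm_sum_smul_branch_le φ t a hc fun k _ => h k)

theorem le_norm_tsum_smul_branch (φ : ι ↪ (ℕ → Bool)) {a : ι → ℝ}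
    (ha : ∀ ε > 0, {k | ε ≤ |a k|}.Finite) (k : ι) :
    |a k| ≤ ‖(∑' k, a k • c0.mkQ (branchIndicator (φ k)) : LinfQuot)‖ :=
  ge_of_tendsto (summable_smul_branch φ ha).hasSum.norm
    ((eventually_ge_atTop {k}).mono fun t ht =>
      le_norm_sum_smul_branch φ t a (Finset.singleton_subset_iff.1 ht))

/-! ### The compact space of a relation -/

variable {D : Type}

/-- The set of pairs in `αD × αD` that meet an axis at infinity or belong to the relation `E`. -/
def relSpace (E : Set (D × D)) : Set (OnePoint D × OnePoint D) :=
  {p | ∀ x y : D, p = (↑x, ↑y) → (x, y) ∈ E}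

theorem nonempty_relSpace_embedding (E : Set (D × D)) (hD : Cardinal.mk D ≤ Cardinal.continuum) :
    Nonempty (relSpace E ↪ (ℕ → Bool)) := by
  have hO : Cardinal.mk (OnePoint D) ≤ Cardinal.continuum := by
    refine (Cardinal.mk_option (α := D)).trans_le ?_
    exact Cardinal.add_le_of_le Cardinal.aleph0_le_continuum hD
      (Cardinal.one_le_aleph0.trans Cardinal.aleph0_le_continuum)
  rw [← Cardinal.le_def]
  refine (Cardinal.mk_subtype_le _).trans ?_
  simpa using mul_le_mul' hO hO

open Classical in
theorem tsum_ite_eq_coe_le (a : OnePoint D) :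
    ∑' x : D, ENNReal.ofReal |if a = (x : OnePoint D) then (1 / 2 : ℝ) else 0| ≤
      ENNReal.ofReal (1 / 2) := by
  induction a using OnePoint.rec with
  | infty => simp
  | coe z =>
    rw [tsum_eq_single z]
    · simp
    · intro x hx
      simp [hx.symm]

variable [TopologicalSpace D]

/-- The projection of `relSpace E` to the first axis. -/
def relFst (E : Set (D × D)) : C(OnePoint D, relSpace E) where
  toFun a := ⟨(a, OnePoint.infty),
    fun _ y h => (OnePoint.infty_ne_coe y (congrArg Prod.snd h)).elim⟩

/-- The projection of `relSpace E` to the second axis. -/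
def relSnd (E : Set (D × D)) : C(OnePoint D, relSpace E) where
  toFun b := ⟨(OnePoint.infty, b),
    fun x _ h => (OnePoint.infty_ne_coe x (congrArg Prod.fst h)).elim⟩

open Classical in
/-- The coefficients of `f` in the decomposition along the two axes. -/
def relCoeff (E : Set (D × D)) (f : C(relSpace E, ℝ)) (p : relSpace E) : ℝ :=
  if p.1.1 = OnePoint.infty then
    if p.1.2 = OnePoint.infty then f p else f p - f (relFst E OnePoint.infty)
  else if p.1.2 = OnePoint.infty then f p - f (relFst E OnePoint.infty)
  else f p - f (relFst E p.1.1) - f (relSnd E p.1.2) + f (relFst E OnePoint.infty)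

theorem relCoeff_add (E : Set (D × D)) (f g : C(relSpace E, ℝ)) (p : relSpace E) :
    relCoeff E (f + g) p = relCoeff E f p + relCoeff E g p := by
  simp only [relCoeff, ContinuousMap.add_apply]
  split_ifs <;> ring

theorem relCoeff_smul (E : Set (D × D)) (c : ℝ) (f : C(relSpace E, ℝ)) (p : relSpace E) :
    relCoeff E (c • f) p = c * relCoeff E f p := by
  simp only [relCoeff, ContinuousMap.smul_apply, smul_eq_mul]
  split_ifs <;> ring

theorem relCoeff_infty (E : Set (D × D)) (f : C(relSpace E, ℝ)) :
    relCoeff E f (relFst E OnePoint.infty) = f (relFst E OnePoint.infty) := by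
  simp [relCoeff, relFst]

theorem relCoeff_relFst_coe (E : Set (D × D)) (f : C(relSpace E, ℝ)) (x : D) :
    relCoeff E f (relFst E x) = f (relFst E x) - f (relFst E OnePoint.infty) := by
  simp [relCoeff, relFst]

theorem relCoeff_relSnd_coe (E : Set (D × D)) (f : C(relSpace E, ℝ)) (x : D) :
    relCoeff E f (relSnd E x) = f (relSnd E x) - f (relFst E OnePoint.infty) := by
  simp [relCoeff, relFst, relSnd]

variable [DiscreteTopology D]

theorem isOpen_singleton_onePoint_coe (x : D) : IsOpen ({(x : OnePoint D)} : Set (OnePoint D)) := by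
  rw [← image_singleton]
  exact OnePoint.isOpenEmbedding_coe.isOpenMap _ (isOpen_discrete _)

theorem isOpen_singleton_prod_coe (x y : D) :
    IsOpen ({((x : OnePoint D), (y : OnePoint D))} : Set (OnePoint D × OnePoint D)) := by
  rw [← singleton_prod_singleton]
  exact (isOpen_singleton_onePoint_coe x).prod (isOpen_singleton_onePoint_coe y)

theorem isClosed_relSpace (E : Set (D × D)) : IsClosed (relSpace E) := by
  have : relSpace E = ⋂ (x : D) (y : D) (_ : (x, y) ∉ E),
      ({((x : OnePoint D), (y : OnePoint D))} : Set (OnePoint D × OnePoint D))ᶜ := by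
    ext p
    simp only [relSpace, mem_ofPred_eq, mem_iInter, mem_compl_iff, mem_singleton_iff]
    exact forall₂_congr fun x y => not_imp_not.symm
  rw [this]
  exact isClosed_iInter fun x => isClosed_iInter fun y => isClosed_iInter fun _ =>
    (isOpen_singleton_prod_coe x y).isClosed_compl

instance compactSpace_relSpace (E : Set (D × D)) : CompactSpace (relSpace E) :=
  isCompact_iff_compactSpace.1 (isClosed_relSpace E).isCompact

open Classical in
theorem continuous_ite_eq_coe (x : D) (c : ℝ) :
    Continuous fun a : OnePoint D => if a = (x : OnePoint D) then c else 0 :=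
  continuous_const.if (fun a ha => by
    have : IsClopen {a : OnePoint D | a = (x : OnePoint D)} :=
      ⟨isClosed_singleton, isOpen_singleton_onePoint_coe x⟩
    rw [this.frontier_eq] at ha
    exact ha.elim) continuous_const

open Classical in
theorem isUniformEberlein_relSpace (E : Set (D × D)) : IsUniformEberlein (relSpace E) := by
  refine ⟨inferInstance, inferInstance, D ⊕ D, fun p => ⟨Sum.elim
    (fun x => if p.1.1 = (x : OnePoint D) then 1 / 2 else 0)
    (fun x => if p.1.2 = (x : OnePoint D) then 1 / 2 else 0), ?_, ?_⟩, ?_⟩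
  · rintro (x | x) <;> simp only [Sum.elim_inl, Sum.elim_inr] <;> split_ifs <;> norm_num
  · rw [ENNReal.summable.tsum_sum ENNReal.summable]
    refine (add_le_add (tsum_ite_eq_coe_le p.1.1) (tsum_ite_eq_coe_le p.1.2)).trans ?_
    rw [← ENNReal.ofReal_add (by norm_num) (by norm_num)]
    norm_num
  · refine (Continuous.isClosedEmbedding ?_ ?_).isEmbedding
    · refine Continuous.subtype_mk (continuous_pi ?_) _
      rintro (x | x)
      · exact (continuous_ite_eq_coe x _).comp (continuous_fst.comp continuous_subtype_val)
      · exact (continuous_ite_eq_coe x _).comp (continuous_snd.comp continuous_subtype_val)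
    · have key : ∀ a b : OnePoint D, (∀ x : D, (if a = (x : OnePoint D) then (1 / 2 : ℝ) else 0) =
          if b = (x : OnePoint D) then 1 / 2 else 0) → a = b := by
        intro a b hab
        induction a using OnePoint.rec with
        | coe z =>
          have := hab z
          by_contra hne
          simp [Ne.symm hne] at this
        | infty =>
          induction b using OnePoint.rec with
          | infty => rfl
          | coe z => simpa using hab z
      intro p q hpq
      have h := congrFun (congrArg Subtype.val hpq)
      exact Subtype.ext (Prod.ext (key _ _ fun x => h (Sum.inl x)) (key _ _ fun x => h (Sum.inr x)))

/-! ### The isomorphic embedding -/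

theorem finite_le_abs_of_isolated {X : Type*} [TopologicalSpace X] [CompactSpace X] {g : X → ℝ}
    (hg : Continuous g) (h : ∀ x, g x ≠ 0 → IsOpen ({x} : Set X)) {ε : ℝ} (hε : 0 < ε) :
    {x | ε ≤ |g x|}.Finite := by
  have hcl : IsClosed {x | ε ≤ |g x|} := isClosed_le continuous_const hg.abs
  refine hcl.isCompact.finite (isDiscrete_iff_forall_mem_exists_isOpen.2
    fun x hx => ⟨{x}, h x ?_, ?_⟩)
  · rintro h0
    rw [mem_ofPred_eq, h0, abs_zero] at hx
    exact hx.not_gt hε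
  · exact inter_eq_left.2 (singleton_subset_iff.2 hx)

theorem abs_relCoeff_le (E : Set (D × D)) (f : C(relSpace E, ℝ)) (p : relSpace E) :
    |relCoeff E f p| ≤ 4 * ‖f‖ := by
  have h₁ := abs_le.1 (f.norm_coe_le_norm p)
  have h₂ := abs_le.1 (f.norm_coe_le_norm (relFst E OnePoint.infty))
  have h₃ := abs_le.1 (f.norm_coe_le_norm (relFst E p.1.1))
  have h₄ := abs_le.1 (f.norm_coe_le_norm (relSnd E p.1.2))
  rw [abs_le, relCoeff]
  split_ifs <;> constructor <;> linarith [h₁.1, h₁.2, h₂.1, h₂.2, h₃.1, h₃.2, h₄.1, h₄.2]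

theorem norm_le_of_abs_relCoeff_le (E : Set (D × D)) (f : C(relSpace E, ℝ)) {c : ℝ}
    (h : ∀ p, |relCoeff E f p| ≤ c) : ‖f‖ ≤ 4 * c := by
  have hc : 0 ≤ c := (abs_nonneg _).trans (h (relFst E OnePoint.infty))
  have h₀ := abs_le.1 (relCoeff_infty E f ▸ h _)
  refine (ContinuousMap.norm_le _ (by positivity)).2 fun p => abs_le.2 ?_
  have hp := abs_le.1 (h p)
  obtain ⟨⟨a, b⟩, hab⟩ := p
  induction a using OnePoint.rec with
  | infty =>
    simp only [relCoeff] at hp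
    split_ifs at hp <;> constructor <;> linarith [hp.1, hp.2, h₀.1, h₀.2]
  | coe x =>
    induction b using OnePoint.rec with
    | infty =>
      simp only [relCoeff] at hp
      split_ifs at hp <;> constructor <;> linarith [hp.1, hp.2, h₀.1, h₀.2]
    | coe y =>
      have h₁ := abs_le.1 (relCoeff_relFst_coe E f x ▸ h _)
      have h₂ := abs_le.1 (relCoeff_relSnd_coe E f y ▸ h _)
      simp only [relCoeff, OnePoint.coe_ne_infty, if_false] at hp
      constructor <;> linarith [hp.1, hp.2, h₀.1, h₀.2, h₁.1, h₁.2, h₂.1, h₂.2]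

theorem finite_le_abs_relCoeff (E : Set (D × D)) (f : C(relSpace E, ℝ)) {ε : ℝ} (hε : 0 < ε) :
    {p | ε ≤ |relCoeff E f p|}.Finite := by
  have isolated : ∀ a : OnePoint D, a ≠ OnePoint.infty → IsOpen ({a} : Set (OnePoint D)) := by
    intro a ha
    obtain ⟨x, rfl⟩ := OnePoint.ne_infty_iff_exists.1 ha
    exact isOpen_singleton_onePoint_coe x
  have h₁ : {a | ε ≤ |f (relFst E a) - f (relFst E OnePoint.infty)|}.Finite :=
    finite_le_abs_of_isolated (by fun_prop)
      (fun a ha => isolated a (by rintro rfl; simp at ha)) hε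
  have h₂ : {b | ε ≤ |f (relSnd E b) - f (relFst E OnePoint.infty)|}.Finite :=
    finite_le_abs_of_isolated (by fun_prop)
      (fun a ha => isolated a (by rintro rfl; exact ha (sub_self _))) hε
  have h₃ : {p : relSpace E | ε ≤ |f p - f (relFst E p.1.1) - f (relSnd E p.1.2) +
      f (relFst E OnePoint.infty)|}.Finite := by
    refine finite_le_abs_of_isolated (by fun_prop) ?_ hε
    rintro ⟨⟨a, b⟩, hab⟩ hp
    induction a using OnePoint.rec with
    | infty => exact (hp (by simp [relFst, relSnd])).elim
    | coe x =>
      induction b using OnePoint.rec with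
      | infty => exact (hp (by simp [relFst, relSnd])).elim
      | coe y =>
        convert (isOpen_singleton_prod_coe x y).preimage continuous_subtype_val
        ext q
        simp [Subtype.ext_iff]
  refine ((finite_singleton (relFst E OnePoint.infty)).union
    ((h₁.image (relFst E)).union ((h₂.image (relSnd E)).union h₃))).subset ?_
  rintro ⟨⟨a, b⟩, hab⟩ hp
  simp only [mem_ofPred_eq, relCoeff] at hp
  split_ifs at hp with ha hb hb
  · left
    exact Subtype.ext (Prod.ext ha hb)
  · right; right; left
    obtain rfl : a = OnePoint.infty := ha
    exact ⟨b, hp, rfl⟩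
  · right; left
    obtain rfl : b = OnePoint.infty := hb
    exact ⟨a, hp, rfl⟩
  · right; right; right
    exact hp

theorem exists_isomorphic_embedding_relSpace (E : Set (D × D)) (φ : relSpace E ↪ (ℕ → Bool)) :
    ∃ T : C(relSpace E, ℝ) →L[ℝ] LinfQuot, Function.Injective T ∧
      ∃ c > 0, ∀ g : C(relSpace E, ℝ), c * ‖g‖ ≤ ‖T g‖ := by
  have : IsClosed (c0 : Set Linf) := isClosed_c0
  have hfin := fun (f : C(relSpace E, ℝ)) (ε : ℝ) (hε : ε > 0) => finite_le_abs_relCoeff E f hε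
  let T₀ : C(relSpace E, ℝ) →ₗ[ℝ] LinfQuot :=
    { toFun f := ∑' p, relCoeff E f p • c0.mkQ (branchIndicator (φ p))
      map_add' f g := by
        simp only [relCoeff_add, add_smul]
        exact (summable_smul_branch φ (hfin f)).tsum_add (summable_smul_branch φ (hfin g))
      map_smul' c f := by
        simp only [relCoeff_smul, mul_smul, RingHom.id_apply]
        exact (summable_smul_branch φ (hfin f)).tsum_const_smul c }
  let T := T₀.mkContinuous 4 fun f =>
    norm_tsum_smul_branch_le φ (hfin f) (by positivity) (abs_relCoeff_le E f)
  have hT : ∀ g, (1 / 4 : ℝ) * ‖g‖ ≤ ‖T g‖ := fun g => by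
    have := norm_le_of_abs_relCoeff_le E g (le_norm_tsum_smul_branch φ (hfin g))
    change (1 / 4 : ℝ) * ‖g‖ ≤ ‖(∑' p, relCoeff E g p • c0.mkQ (branchIndicator (φ p)) : LinfQuot)‖
    linarith
  refine ⟨T, (injective_iff_map_eq_zero T).2 fun g hg => ?_, 1 / 4, by norm_num, hT⟩
  have := hT g
  rw [hg, norm_zero] at this
  exact norm_le_zero_iff.1 (by linarith)

/-! ### Isometric embeddings force rectangle measurability -/

open Classical in
/-- The indicator of the points of `relSpace E` with first coordinate `x`. -/
def fstIndicator (E : Set (D × D)) (x : D) : C(relSpace E, ℝ) where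
  toFun p := if p.1.1 = (x : OnePoint D) then 1 else 0
  continuous_toFun :=
    (continuous_ite_eq_coe x 1).comp (continuous_fst.comp continuous_subtype_val)

open Classical in
/-- The indicator of the points of `relSpace E` with second coordinate `y`. -/
def sndIndicator (E : Set (D × D)) (y : D) : C(relSpace E, ℝ) where
  toFun p := if p.1.2 = (y : OnePoint D) then 1 else 0
  continuous_toFun :=
    (continuous_ite_eq_coe y 1).comp (continuous_snd.comp continuous_subtype_val)

theorem two_le_norm_of_mem {E : Set (D × D)} {x y : D} (h : (x, y) ∈ E) :
    2 ≤ ‖fstIndicator E x + sndIndicator E y‖ := by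
  have hp : ((x : OnePoint D), (y : OnePoint D)) ∈ relSpace E := by
    intro x' y' h'
    obtain ⟨hx, hy⟩ := Prod.ext_iff.1 h'
    rwa [← OnePoint.coe_injective hx, ← OnePoint.coe_injective hy]
  refine le_trans ?_ ((fstIndicator E x + sndIndicator E y).norm_coe_le_norm ⟨_, hp⟩)
  simp [fstIndicator, sndIndicator]
  norm_num

theorem norm_le_one_of_notMem {E : Set (D × D)} {x y : D} (h : (x, y) ∉ E) :
    ‖fstIndicator E x + sndIndicator E y‖ ≤ 1 := by
  refine (ContinuousMap.norm_le _ zero_le_one).2 fun p => ?_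
  simp only [ContinuousMap.add_apply, fstIndicator, sndIndicator, ContinuousMap.coe_mk]
  split_ifs with h₁ h₂
  · exact (h (p.2 x y (Prod.ext h₁ h₂))).elim
  all_goals simp

theorem exists_mem_iff_frequently {E : Set (D × D)} (S : C(relSpace E, ℝ) →ₗᵢ[ℝ] LinfQuot) :
    ∃ a b : D → ℕ → ℝ, ∀ x y, (x, y) ∈ E ↔ ∃ᶠ n in atTop, 3 / 2 ≤ |a x n + b y n| := by
  choose a ha using fun x => c0.mkQ_surjective (S (fstIndicator E x))
  choose b hb using fun y => c0.mkQ_surjective (S (sndIndicator E y))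
  have hnorm : ∀ x y, ‖(c0.mkQ (a x + b y) : LinfQuot)‖ =
      ‖fstIndicator E x + sndIndicator E y‖ := fun x y => by
    rw [map_add, ha, hb, ← map_add, S.norm_map]
  refine ⟨fun x n => a x n, fun y n => b y n, fun x y => ⟨fun h => ?_, fun h => ?_⟩⟩
  · by_contra hf
    have hev : ∀ᶠ n in atTop, |(a x + b y) n| ≤ 3 / 2 := by
      filter_upwards [not_frequently.1 hf] with n hn
      exact (not_le.1 hn).le
    have := (hnorm x y).symm.trans_le (norm_mk_le_of_eventually (by norm_num) hev)
    linarith [two_le_norm_of_mem h]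
  · by_contra hE
    have hlt : ‖(c0.mkQ (a x + b y) : LinfQuot)‖ < 3 / 2 := by
      rw [hnorm]
      exact (norm_le_one_of_notMem hE).trans_lt (by norm_num)
    refine h ?_
    filter_upwards [eventually_lt_of_norm_mk_lt hlt] with n hn
    exact not_le.2 hn

theorem measurable_P2_fst (u : ℝ → ℝ) : Measurable[P2] fun p : ℝ × ℝ => u p.1 := fun s _ =>
  MeasurableSpace.measurableSet_generateFrom ⟨u ⁻¹' s, univ, by ext; simp⟩

theorem measurable_P2_snd (u : ℝ → ℝ) : Measurable[P2] fun p : ℝ × ℝ => u p.2 := fun s _ =>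
  MeasurableSpace.measurableSet_generateFrom ⟨univ, u ⁻¹' s, by ext; simp⟩

theorem measurableSet_P2_frequently (a b : ℝ → ℕ → ℝ) (c : ℝ) :
    MeasurableSet[P2] {p : ℝ × ℝ | ∃ᶠ n in atTop, c ≤ |a p.1 n + b p.2 n|} := by
  let _ : MeasurableSpace (ℝ × ℝ) := P2
  simp only [frequently_atTop, ofPred_forall, ofPred_exists, ofPred_and]
  refine MeasurableSet.iInter fun N => MeasurableSet.iUnion fun n =>
    (MeasurableSet.const _).inter ?_
  have hm : Measurable fun p : ℝ × ℝ => a p.1 n + b p.2 n :=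
    (measurable_P2_fst fun x => a x n).add (measurable_P2_snd fun y => b y n)
  exact measurableSet_le measurable_const hm.abs

/-- If `𝔠` is not a Kunen cardinal, then there is a uniform Eberlein compact space `K` such
that `C(K)` embeds isomorphically but not isometrically into `ℓ∞/c₀`. -/
theorem stmt_8 (h : ¬ ∀ E : Set (ℝ × ℝ), MeasurableSet[P2] E) :
    ∃ (K : Type) (_ : TopologicalSpace K) (_ : CompactSpace K),
      IsUniformEberlein K ∧
      (∃ T : C(K, ℝ) →L[ℝ] LinfQuot, Function.Injective T ∧
        ∃ c > 0, ∀ g : C(K, ℝ), c * ‖g‖ ≤ ‖T g‖) ∧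
      IsEmpty (C(K, ℝ) →ₗᵢ[ℝ] LinfQuot) := by
  push Not at h
  obtain ⟨E, hE⟩ := h
  let _ : TopologicalSpace ℝ := ⊥
  have _ : DiscreteTopology ℝ := ⟨rfl⟩
  obtain ⟨φ⟩ := nonempty_relSpace_embedding E Cardinal.mk_real.le
  refine ⟨relSpace E, inferInstance, inferInstance, isUniformEberlein_relSpace E,
    exists_isomorphic_embedding_relSpace E φ, ⟨fun S => hE ?_⟩⟩
  obtain ⟨a, b, hab⟩ := exists_mem_iff_frequently S
  convert measurableSet_P2_frequently a b (3 / 2) using 1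
  exact Set.ext fun p => hab p.1 p.2
end
end

section
/- If a compact Hausdorff space K is a continuous image of the countable product σ₁(𝔠)^ω, then the Banach space C(K) embeds isometrically into ℓ∞/c₀. -/
open Filter Topology Set MeasureTheory

noncomputable section

/-- `σ_n(Γ) = {x ∈ {0,1}^Γ : |{γ : x_γ ≠ 0}| ≤ n}` as a subspace of the product `{0,1}^Γ`. -/
def sigmaSet (Γ : Type u) (n : ℕ) : Set (Γ → Bool) :=
  {x | {γ | x γ = true}.encard ≤ (n : ℕ∞)}

/-- The free ultrafilters on `ℕ`, i.e. the space `βω ∖ ω`. -/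
def freeUltrafilters : Set (Ultrafilter ℕ) := {U | (U : Filter ℕ) ≤ cofinite}

lemma isClosed_freeUltrafilters : IsClosed freeUltrafilters := by
  have : freeUltrafilters = ⋂ n : ℕ, {U : Ultrafilter ℕ | {n}ᶜ ∈ U} := by
    ext U
    simp [freeUltrafilters, le_cofinite_iff_compl_singleton_mem]
  rw [this]
  exact isClosed_iInter fun n => ultrafilter_isClosed_basic _

instance : CompactSpace freeUltrafilters :=
  isCompact_iff_compactSpace.mp isClosed_freeUltrafilters.isCompact

/-- Every continuous function on `βω ∖ ω` is given by the ultrafilter limits of a bounded sequence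
of the same norm. -/
lemma exists_linf_tendsto (f : C(freeUltrafilters, ℝ)) :
    ∃ a : Linf, ‖a‖ ≤ ‖f‖ ∧ ∀ U : freeUltrafilters, Tendsto a (U : Ultrafilter ℕ) (𝓝 (f U)) := by
  obtain ⟨g, hg, hgf⟩ := BoundedContinuousFunction.exists_norm_eq_domRestrict_eq_of_closed
    (BoundedContinuousFunction.mkOfCompact f) isClosed_freeUltrafilters
  have hbound (n : ℕ) : ‖g (pure n)‖ ≤ ‖f‖ := by
    rw [← BoundedContinuousFunction.norm_mkOfCompact, ← hg]
    exact g.norm_coe_le_norm _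
  refine ⟨⟨fun n => g (pure n), memℓp_infty ⟨‖f‖, by rintro _ ⟨n, rfl⟩; exact hbound n⟩⟩,
    lp.norm_le_of_forall_le (norm_nonneg f) hbound, fun U => ?_⟩
  have hU : g U = f U := DFunLike.congr_fun hgf U
  rw [← hU]
  exact (g.continuous.tendsto _).comp (Ultrafilter.tendsto_pure_self (U : Ultrafilter ℕ))

lemma mem_c0_iff_ultrafilter (a : Linf) :
    a ∈ c0 ↔ ∀ U : freeUltrafilters, Tendsto a (U : Ultrafilter ℕ) (𝓝 0) := by
  change Tendsto a atTop (𝓝 0) ↔ _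
  rw [← Nat.cofinite_eq_atTop, tendsto_iff_ultrafilter]
  exact ⟨fun h U => h U U.2, fun h U hU => h ⟨U, hU⟩⟩

/-- If `K` is a continuous image of `βω ∖ ω`, then `C(K)` embeds isometrically into `ℓ∞/c₀`. -/
theorem nonempty_linearIsometry_of_surjective {K : Type*} [TopologicalSpace K] [CompactSpace K]
    (q : C(freeUltrafilters, K)) (hq : Function.Surjective q) :
    Nonempty (C(K, ℝ) →ₗᵢ[ℝ] LinfQuot) := by
  choose a ha hlim using fun f : C(K, ℝ) => exists_linf_tendsto (f.comp q)
  let T : C(K, ℝ) →ₗ[ℝ] LinfQuot :=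
    { toFun := fun f => Submodule.Quotient.mk (a f)
      map_add' := fun f g => by
        rw [← Submodule.Quotient.mk_add, Submodule.Quotient.eq, mem_c0_iff_ultrafilter]
        intro U
        have := (hlim (f + g) U).sub ((hlim f U).add (hlim g U))
        rwa [show (f + g).comp q U - (f.comp q U + g.comp q U) = 0 from sub_self _] at this
      map_smul' := fun r f => by
        rw [RingHom.id_apply, ← Submodule.Quotient.mk_smul, Submodule.Quotient.eq,
          mem_c0_iff_ultrafilter]
        intro U
        have := (hlim (r • f) U).sub ((hlim f U).const_mul r)
        rwa [show (r • f).comp q U - r * f.comp q U = 0 from sub_self _] at this }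
  refine ⟨⟨T, fun f => le_antisymm ?_ ?_⟩⟩
  · calc ‖T f‖ ≤ ‖a f‖ := Submodule.Quotient.norm_mk_le c0 (a f)
      _ ≤ ‖f.comp q‖ := ha f
      _ ≤ ‖f‖ := (ContinuousMap.norm_le _ (norm_nonneg f)).2 fun U => f.norm_coe_le_norm (q U)
  · rw [ContinuousMap.norm_le _ (norm_nonneg _)]
    intro x
    obtain ⟨U, rfl⟩ := hq x
    refine le_of_forall_pos_le_add fun ε hε => ?_
    obtain ⟨b, hb, hbε⟩ := Submodule.Quotient.norm_mk_lt (T f) hε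
    have hsub : b - a f ∈ c0 := (Submodule.Quotient.eq c0).1 hb
    have hb_lim : Tendsto b (U : Ultrafilter ℕ) (𝓝 (f (q U))) := by
      simpa using ((mem_c0_iff_ultrafilter _).1 hsub U).add (hlim f U)
    exact (le_of_tendsto hb_lim.norm
      (Eventually.of_forall fun n => lp.norm_apply_le_norm ENNReal.top_ne_zero b n)).trans hbε.le

/-- Finite approximations of points of `({0,1}^ω ∪ {∞})^ω`: at level `n`, the first `n`
coordinates, each truncated to its first `n` bits. -/
abbrev Approx : Type := Σ n : ℕ, Fin n → Option (Fin n → Bool)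

/-- The codes of the approximations whose `k`-th coordinate is a truncation of `x`. -/
def branch (k : ℕ) (x : ℕ → Bool) : Set ℕ :=
  Encodable.encode '' {d : Approx | ∃ hk : k < d.1, d.2 ⟨k, hk⟩ = some fun i : Fin d.1 => x i}

lemma finite_branch_inter (k : ℕ) {x y : ℕ → Bool} (hxy : x ≠ y) :
    (branch k x ∩ branch k y).Finite := by
  obtain ⟨i, hi⟩ := Function.ne_iff.1 hxy
  rw [branch, branch, ← image_inter Encodable.encode_injective]
  refine Finite.image _ (Finite.subset
    (Set.finite_range fun e : Σ n : Fin (i + 1), Fin n → Option (Fin n → Bool) =>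
      (⟨e.1, e.2⟩ : Approx)) ?_)
  rintro ⟨n, s⟩ ⟨⟨hk, h₁⟩, ⟨_, h₂⟩⟩
  have hn : n ≤ i := by
    by_contra! hin
    exact hi (congrFun (Option.some_injective _ (h₁.symm.trans h₂)) ⟨i, hin⟩)
  exact ⟨⟨⟨n, Nat.lt_succ_of_le hn⟩, s⟩, rfl⟩

lemma eq_of_branch_mem {U : Ultrafilter ℕ} (hU : U ∈ freeUltrafilters) {k : ℕ} {x y : ℕ → Bool}
    (hx : branch k x ∈ U) (hy : branch k y ∈ U) : x = y := by
  by_contra hxy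
  exact Ultrafilter.compl_mem_iff_notMem.1 (hU (finite_branch_inter k hxy).compl_mem_cofinite)
    (inter_mem hx hy)

/-- A sequence of options of binary sequences yields a free ultrafilter that contains exactly the
branches the sequence prescribes. -/
lemma exists_freeUltrafilter_branch_mem_iff (z : ℕ → Option (ℕ → Bool)) :
    ∃ U ∈ freeUltrafilters, ∀ k x, branch k x ∈ U ↔ z k = some x := by
  let d : ℕ → Approx := fun n => ⟨n, fun k => (z k).map fun x i => x i⟩
  have hd : Function.Injective fun n => Encodable.encode (d n) := fun m n h =>
    congrArg Sigma.fst (Encodable.encode_injective h)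
  have hmem (n k : ℕ) (x : ℕ → Bool) : Encodable.encode (d n) ∈ branch k x ↔
      k < n ∧ (z k).map (fun y (i : Fin n) => y i) = some fun i : Fin n => x i := by
    rw [branch, Encodable.encode_injective.mem_set_image]
    simp [d, -Option.map_eq_some_iff]
  let U : Ultrafilter ℕ := (hyperfilter ℕ).map fun n => Encodable.encode (d n)
  have hyp : (hyperfilter ℕ : Filter ℕ) ≤ atTop := Nat.cofinite_eq_atTop ▸ hyperfilter_le_cofinite
  refine ⟨U, hd.tendsto_cofinite.mono_left hyperfilter_le_cofinite, fun k x => ⟨fun h => ?_,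
    fun h => ?_⟩⟩
  · have hev : ∀ᶠ n in (hyperfilter ℕ : Filter ℕ), Encodable.encode (d n) ∈ branch k x := h
    simp only [hmem] at hev
    cases hz : z k with
    | none => simp [hz, (hyperfilter ℕ).neBot.ne] at hev
    | some y =>
      congr 1
      by_contra hyx
      obtain ⟨i, hi⟩ := Function.ne_iff.1 hyx
      obtain ⟨n, ⟨-, hn⟩, hin⟩ := (hev.and (hyp (eventually_gt_atTop i))).exists
      rw [hz] at hn
      exact hi (congrFun (Option.some_injective _ hn) ⟨i, hin⟩)
  · change ∀ᶠ n in (hyperfilter ℕ : Filter ℕ), Encodable.encode (d n) ∈ branch k x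
    filter_upwards [hyp (eventually_gt_atTop k)] with n hn
    simp [hmem, h, hn]

lemma mem_sigmaSet_one_iff {Γ : Type*} {x : Γ → Bool} :
    x ∈ sigmaSet Γ 1 ↔ ∀ γ δ, x γ = true → x δ = true → γ = δ := by
  simp [sigmaSet, Set.encard_le_one_iff]

open Classical in
/-- `σ₁(Γ)^ω` is a continuous image of `βω ∖ ω` whenever `Γ` has size at most continuum. -/
theorem exists_surjective_sigmaSet_one {Γ : Type*} (c : Γ ↪ (ℕ → Bool)) :
    ∃ h : C(freeUltrafilters, ℕ → sigmaSet Γ 1), Function.Surjective h := by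
  let h : freeUltrafilters → ℕ → sigmaSet Γ 1 := fun U k =>
    ⟨fun γ => decide (branch k (c γ) ∈ (U : Ultrafilter ℕ)), mem_sigmaSet_one_iff.2
      fun γ δ hγ hδ => c.injective (eq_of_branch_mem U.2 (of_decide_eq_true hγ)
        (of_decide_eq_true hδ))⟩
  have hcont : Continuous h := by
    refine continuous_pi fun k => Continuous.subtype_mk (continuous_pi fun γ => ?_) _
    refine Continuous.comp (g := fun U : Ultrafilter ℕ => decide (branch k (c γ) ∈ U)) ?_
      continuous_subtype_val
    refine (continuous_bool_rng true).2 ?_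
    have : (fun U : Ultrafilter ℕ => decide (branch k (c γ) ∈ U)) ⁻¹' {true} =
        {U | branch k (c γ) ∈ U} := by ext; simp
    rw [this]
    exact ⟨ultrafilter_isClosed_basic _, ultrafilter_isOpen_basic _⟩
  refine ⟨⟨h, hcont⟩, fun p => ?_⟩
  have hz (k : ℕ) : ∃ z : Option (ℕ → Bool), ∀ γ, z = some (c γ) ↔ (p k).1 γ = true := by
    by_cases hk : ∃ γ, (p k).1 γ = true
    · obtain ⟨γ, hγ⟩ := hk
      refine ⟨some (c γ), fun δ => ⟨fun e => ?_, fun hδ => ?_⟩⟩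
      · rwa [← c.injective (Option.some_injective _ e)]
      · rw [mem_sigmaSet_one_iff.1 (p k).2 γ δ hγ hδ]
    · exact ⟨none, fun γ => by simpa using fun hγ => hk ⟨γ, hγ⟩⟩
  choose z hz using hz
  obtain ⟨U, hU, hUz⟩ := exists_freeUltrafilter_branch_mem_iff z
  refine ⟨⟨U, hU⟩, funext fun k => Subtype.ext (funext fun γ => ?_)⟩
  change decide (branch k (c γ) ∈ U) = (p k).1 γ
  rw [Bool.eq_iff_iff, decide_eq_true_iff, hUz, hz]

/-- If a compact Hausdorff space `K` is a continuous image of `σ₁(𝔠)^ω` (realized with the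
index set `ℝ` of cardinality `𝔠`), then `C(K)` embeds isometrically into `ℓ∞/c₀`. -/
theorem stmt_9 (K : Type*) [TopologicalSpace K] [CompactSpace K] [T2Space K]
    (h : ∃ g : (ℕ → ↥(sigmaSet ℝ 1)) → K, Continuous g ∧ Function.Surjective g) :
    Nonempty (C(K, ℝ) →ₗᵢ[ℝ] LinfQuot) := by
  obtain ⟨g, hg, hg_surj⟩ := h
  have hcard : Cardinal.mk ℝ = Cardinal.mk (ℕ → Bool) := by simp [Cardinal.mk_real]
  obtain ⟨c⟩ := Cardinal.eq.1 hcard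
  obtain ⟨h, hh⟩ := exists_surjective_sigmaSet_one c.toEmbedding
  exact nonempty_linearIsometry_of_surjective (ContinuousMap.comp ⟨g, hg⟩ h) (hg_surj.comp hh)
end
end
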